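/- arXiv:1507.06277 — 6 statements merged into one kernel-verified Lean document; each statement's English description precedes it below -/
import Mathlib

section
/- Let k be a field, K/k a finite cyclic extension, and K_i/k a finite separable field extension such that the K_i-algebra K ⊗_k K_i is isomorphic to a finite product of copies of a single field M_i with [M_i : K_i] = d_i. Then for every x ∈ K_i^×, the element N_{K_i/k}(x)^{d_i} is a norm from K: there exists y ∈ K^× with N_{K_i/k}(x)^{d_i} = N_{K/k}(y). In particular, if d_i = 1 then N_{K_i/k}(x) ∈ N_{K/k}(K^×) for every x ∈ K_i^×. (Lemma 6.1, restated via the isomorphism Br(K/k) ≅ k^×/N_{K/k}(K^×) for cyclic K/k: the cyclic algebra (K, N_{K_i/k}(x)) has order dividing d_i in the Brauer group of k.) -/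
open scoped TensorProduct

/-- If an extension `M` of `E` also contains `K` compatibly over `k`, then by transitivity of norms
`N_{E/k}(x)^[M : E] = N_{K/k}(N_{M/K}(x))`. -/
theorem Algebra.norm_pow_finrank_eq_norm_norm {k K E M : Type*} [Field k] [Field K] [Field E]
    [Field M] [Algebra k K] [Algebra k E] [Algebra k M] [Algebra E M] [Algebra K M]
    [IsScalarTower k E M] [IsScalarTower k K M] (x : E) :
    Algebra.norm k x ^ Module.finrank E M =
      Algebra.norm k (Algebra.norm K (algebraMap E M x)) := by
  rw [Algebra.norm_norm, ← Algebra.norm_norm (S := E) (a := algebraMap E M x),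
    Algebra.norm_algebraMap, map_pow]

/-- Lemma 6.1 (restated via `Br(K/k) ≅ k^×/N_{K/k}(K^×)` for cyclic `K/k`): if `K/k` is a finite
cyclic extension, `Kᵢ/k` a finite separable extension such that `K ⊗_k Kᵢ` is a product of copies
of a single field `Mᵢ` with `[Mᵢ : Kᵢ] = dᵢ`, then for every `x ∈ Kᵢ^×` the element
`N_{Kᵢ/k}(x)^{dᵢ}` is a norm from `K`. -/
theorem pow_norm_isNorm_of_splits (k : Type) [Field k]
    (K : Type) [Field K] [Algebra k K] [FiniteDimensional k K]
    [IsGalois k K] [IsCyclic (K ≃ₐ[k] K)]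
    (Ki : Type) [Field Ki] [Algebra k Ki] [FiniteDimensional k Ki] [Algebra.IsSeparable k Ki]
    (Mi : Type) [Field Mi] [Algebra Ki Mi] [FiniteDimensional Ki Mi]
    (hsplit : ∃ m : ℕ, Nonempty ((Ki ⊗[k] K) ≃ₐ[Ki] (Fin m → Mi)))
    (x : Kiˣ) :
    ∃ y : Kˣ, (Algebra.norm k (x : Ki)) ^ (Module.finrank Ki Mi)
      = Algebra.norm k (y : K) := by
  obtain ⟨m, ⟨e⟩⟩ := hsplit
  have : Nonempty (Fin m) := by
    by_contra h
    rw [not_nonempty_iff] at h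
    exact not_subsingleton (Ki ⊗[k] K) e.toEquiv.subsingleton
  obtain ⟨i⟩ := this
  algebraize [(algebraMap Ki Mi).comp (algebraMap k Ki)]
  have : IsScalarTower k Ki Mi := .of_algebraMap_eq fun _ => rfl
  let f : K →ₐ[k] Mi := (((Pi.evalAlgHom Ki (fun _ : Fin m => Mi) i).comp
    e.toAlgHom).restrictScalars k).comp Algebra.TensorProduct.includeRight
  let := f.toRingHom.toAlgebra
  have : IsScalarTower k K Mi := .of_algebraMap_eq fun a => (f.commutes a).symm
  exact ⟨Units.map (Algebra.norm K) (Units.map (algebraMap Ki Mi).toMonoidHom x),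
    Algebra.norm_pow_finrank_eq_norm_norm (x : Ki)⟩
end

section
/- Let k be a field, K/k a finite cyclic extension of degree d, K' a finite étale k-algebra with norm N_{K'/k}, and c ∈ k^×. For each prime p dividing d, let K(p) be the unique intermediate field of K/k with [K(p):k] equal to the largest power of p dividing d. Then the equation N_{K/k}(x) · N_{K'/k}(y) = c has a solution with x ∈ K^× and y a unit of K' if and only if for every prime p dividing d the equation N_{K(p)/k}(x_p) · N_{K'/k}(y_p) = c has a solution with x_p ∈ K(p)^× and y_p a unit of K'. (Lemma 7.15.) -/
/-- An element of a group whose `n`-th power and whose powers by the prime-to-`p` parts of `n`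
all lie in a normal subgroup lies in that subgroup. -/
theorem Subgroup.mem_of_pow_ordCompl_mem {G : Type*} [Group G] (H : Subgroup G) [H.Normal]
    {n : ℕ} (hn : n ≠ 0) {g : G} (hg : g ^ n ∈ H)
    (h : ∀ p : ℕ, p.Prime → p ∣ n → g ^ (n / p ^ n.factorization p) ∈ H) : g ∈ H := by
  have dvd_of_mem (e : ℕ) (he : g ^ e ∈ H) : orderOf (g : G ⧸ H) ∣ e := by
    apply orderOf_dvd_of_pow_eq_one
    rwa [← QuotientGroup.mk_pow, QuotientGroup.eq_one_iff]
  rw [← QuotientGroup.eq_one_iff, ← orderOf_eq_one_iff]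
  by_contra hne
  obtain ⟨p, hp, hpo⟩ := Nat.exists_prime_and_dvd hne
  have hpn := hpo.trans (dvd_of_mem n hg)
  exact Nat.not_dvd_ordCompl hp hn (hpo.trans (dvd_of_mem _ (h p hp hpn)))

/-- The norm of an element of an intermediate field `F` of `K/k`, taken in `K`, is the power
of its norm in `F` with exponent `[K : F]`. -/
theorem IntermediateField.norm_coe_eq_norm_pow {k K : Type*} [Field k] [Field K] [Algebra k K]
    [FiniteDimensional k K] (F : IntermediateField k K) (x : F) :
    Algebra.norm k (x : K) = Algebra.norm k x ^ Module.finrank F K := by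
  rw [← Algebra.norm_norm (S := F), ← IntermediateField.algebraMap_apply,
    Algebra.norm_algebraMap, map_pow]

/-- Lemma 7.15: for a cyclic extension `K/k` of degree `d`, a finite étale `k`-algebra
`K' = ∏ⱼ K'ⱼ` and `c ∈ k^×`, the equation `N_{K/k}(x) N_{K'/k}(y) = c` is solvable if and only
if, for every prime `p ∣ d`, the analogous equation for the `p`-primary part `K(p)` of `K`
(the intermediate field of degree the `p`-part of `d`) is solvable. -/
theorem multinorm_solvable_iff_solvable_at_primary_parts (k : Type) [Field k]
    (K : Type) [Field K] [Algebra k K] [FiniteDimensional k K]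
    [IsGalois k K] [IsCyclic (K ≃ₐ[k] K)]
    (d : ℕ) (hd : Module.finrank k K = d)
    (m : ℕ) (K' : Fin m → Type) [∀ j, Field (K' j)] [∀ j, Algebra k (K' j)]
    [∀ j, FiniteDimensional k (K' j)] [∀ j, Algebra.IsSeparable k (K' j)]
    (P : ℕ → IntermediateField k K)
    (hP : ∀ p : ℕ, p.Prime → p ∣ d →
      Module.finrank k (P p) = p ^ (d.factorization p))
    (c : kˣ) :
    (∃ (x : Kˣ) (y : (∀ j, K' j)ˣ),
        Algebra.norm k (x : K) * Algebra.norm k ((y : ∀ j, K' j)) = (c : k)) ↔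
    (∀ p : ℕ, p.Prime → p ∣ d →
      ∃ (xp : (P p)ˣ) (yp : (∀ j, K' j)ˣ),
        Algebra.norm k (xp : P p) * Algebra.norm k ((yp : ∀ j, K' j)) = (c : k)) := by
  constructor
  · rintro ⟨x, y, hxy⟩ p - -
    refine ⟨Units.map (Algebra.norm (P p)) x, y, ?_⟩
    rw [Units.coe_map, Algebra.norm_norm, hxy]
  · intro h
    let H : Subgroup kˣ := (Units.map (Algebra.norm k (S := K))).range ⊔
      (Units.map (Algebra.norm k (S := ∀ j, K' j))).range
    have mem_H (a : kˣ) (x : Kˣ) (y : (∀ j, K' j)ˣ)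
        (hxy : Algebra.norm k (x : K) * Algebra.norm k (y : ∀ j, K' j) = (a : k)) : a ∈ H :=
      Subgroup.mem_sup.mpr ⟨_, ⟨x, rfl⟩, _, ⟨y, rfl⟩, Units.ext hxy⟩
    have hc : c ∈ H := by
      apply H.mem_of_pow_ordCompl_mem (n := d) (hd ▸ Module.finrank_pos.ne')
      · refine mem_H _ (Units.map (algebraMap k K : k →* K) c) 1 ?_
        simp [Algebra.norm_algebraMap, hd]
      · intro p hp hpd
        obtain ⟨x, y, hxy⟩ := h p hp hpd
        have hdeg : d / p ^ d.factorization p = Module.finrank (P p) K := by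
          rw [← hP p hp hpd, ← hd, ← Module.finrank_mul_finrank k (P p) K]
          exact Nat.mul_div_cancel_left _ Module.finrank_pos
        refine mem_H _ (Units.map (algebraMap (P p) K : P p →* K) x)
          (y ^ (d / p ^ d.factorization p)) ?_
        rw [Units.val_pow_eq_pow_val, Units.val_pow_eq_pow_val, map_pow, ← hxy, mul_pow, hdeg,
          ← IntermediateField.norm_coe_eq_norm_pow]
        rfl
    obtain ⟨_, ⟨x, rfl⟩, _, ⟨y, rfl⟩, hxy⟩ := Subgroup.mem_sup.mp hc
    exact ⟨x, y, congrArg Units.val hxy⟩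
end

section
/- Let k be a field, L a finite étale k-algebra with norm map N_{L/k}, and c ∈ k^×. Let F_1, …, F_s be finite separable field extensions of k whose degrees r_j = [F_j : k] satisfy gcd(r_1, …, r_s) = 1. If for each j = 1, …, s there exists a unit z_j of the F_j-algebra L ⊗_k F_j with N_{(L ⊗_k F_j)/F_j}(z_j) = c, then there exists a unit z of L with N_{L/k}(z) = c. (The descent step in the proof of Proposition 7.17: choosing b_j ∈ ℤ with Σ b_j r_j = 1, the element with components ∏_j N_{(F_j ⊗_k K_i)/K_i}(x_{j,i})^{b_j} is a k-point.) -/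
open scoped TensorProduct

/-- Descent of norms along a finite free extension: if `c` is the norm of a unit of `F ⊗ L`
over `F`, then `c ^ [F : k]` is the norm of a unit of `L` over `k`. -/
theorem exists_units_norm_eq_pow_finrank {k L F : Type*} [CommRing k] [Nontrivial k] [CommRing L]
    [Algebra k L] [Module.Free k L] [Module.Finite k L] [CommRing F] [Algebra k F]
    [Module.Free k F] [Module.Finite k F] (c : k) (z : (F ⊗[k] L)ˣ)
    (hz : Algebra.norm F (z : F ⊗[k] L) = algebraMap k F c) :
    ∃ w : Lˣ, Algebra.norm k (w : L) = c ^ Module.finrank k F := by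
  let e := Algebra.TensorProduct.comm k F L
  refine ⟨Units.map (Algebra.norm L) (Units.map (e : F ⊗[k] L →* L ⊗[k] F) z), ?_⟩
  calc Algebra.norm k (Algebra.norm L (e z))
      = Algebra.norm k (e z) := Algebra.norm_norm
    _ = Algebra.norm k (z : F ⊗[k] L) := Algebra.norm_eq_of_algEquiv e _
    _ = Algebra.norm k (Algebra.norm F (z : F ⊗[k] L)) := Algebra.norm_norm.symm
    _ = c ^ Module.finrank k F := by
      rw [hz, Algebra.norm_algebraMap_of_basis (Module.Free.chooseBasis k F),
        Module.finrank_eq_card_chooseBasisIndex]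

/-- The descent step in the proof of Proposition 7.17: if `L` is a finite étale `k`-algebra,
`F₁, …, Fₛ` are finite separable extensions of `k` whose degrees have gcd `1`, and `c ∈ k^×`
is a multinorm for `L ⊗_k Fⱼ` over every `Fⱼ`, then `c` is a multinorm for `L` over `k`. -/
theorem multinorm_of_multinorm_over_coprime_extensions (k : Type) [Field k]
    (m : ℕ) (Kf : Fin m → Type) [∀ i, Field (Kf i)] [∀ i, Algebra k (Kf i)]
    [∀ i, FiniteDimensional k (Kf i)] [∀ i, Algebra.IsSeparable k (Kf i)]
    (s : ℕ) (F : Fin s → Type) [∀ j, Field (F j)] [∀ j, Algebra k (F j)]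
    [∀ j, FiniteDimensional k (F j)] [∀ j, Algebra.IsSeparable k (F j)]
    (hgcd : (Finset.univ.gcd fun j => Module.finrank k (F j)) = 1)
    (c : kˣ)
    (hloc : ∀ j, ∃ z : ((F j) ⊗[k] (∀ i, Kf i))ˣ,
      Algebra.norm (F j) (z : (F j) ⊗[k] (∀ i, Kf i)) = algebraMap k (F j) (c : k)) :
    ∃ z : (∀ i, Kf i)ˣ, Algebra.norm k ((z : ∀ i, Kf i)) = (c : k) := by
  choose z hz using hloc
  choose w hw using fun j => exists_units_norm_eq_pow_finrank (c : k) (z j) (hz j)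
  obtain ⟨b, hb⟩ := Finset.gcd_eq_sum_mul (R := ℤ) .univ fun j => (Module.finrank k (F j) : ℤ)
  have hsum : ∑ j, (Module.finrank k (F j) : ℤ) * b j = 1 := by
    rw [← hb]
    refine Int.eq_one_of_dvd_one Finset.Int.finsetGcd_nonneg (Int.natAbs_dvd.mp ?_)
    rw [← Nat.cast_one, Int.natCast_dvd_natCast, ← hgcd]
    exact Finset.dvd_gcd fun j hj => Int.natAbs_dvd_natAbs.mpr (Finset.gcd_dvd hj)
  have hw' : ∀ j, Units.map (Algebra.norm k) (w j) = c ^ (Module.finrank k (F j) : ℤ) :=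
    fun j => Units.ext (by simpa using hw j)
  refine ⟨∏ j, w j ^ b j, ?_⟩
  have key : Units.map (Algebra.norm k) (∏ j, w j ^ b j) = c := by
    simp_rw [map_prod, map_zpow, hw', ← zpow_mul]
    have hprod := map_sum (zmultiplesHom (Additive kˣ) (Additive.ofMul c))
      (fun j => (Module.finrank k (F j) : ℤ) * b j) .univ
    rw [hsum, zmultiplesHom_apply, one_zsmul] at hprod
    exact hprod.symm
  exact congrArg Units.val key
end

section
/- Let p be a prime, e ≥ 1, k a field, K/k a cyclic extension of degree p^e, and K_0 the unique intermediate field of K/k with [K_0 : k] = p^{e-1}. Let F be any field extension of k. Suppose K ⊗_k F is isomorphic as an F-algebra to a finite product of copies of a field that is a cyclic extension of F of degree p^{e_F}, and K_0 ⊗_k F is isomorphic as an F-algebra to a finite product of copies of a field that is a cyclic extension of F of degree p^{f_F}. Then (i) f_F ≤ e_F; (ii) f_F ≥ e_F − 1; and (iii) if e_F ≠ 0 then e_F = f_F + 1. (Proposition 5.5.) -/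
open scoped TensorProduct

/-- A subgroup of order `n` of a finite cyclic group contains all elements whose `n`-th power
is trivial. -/
lemma Subgroup.mem_of_card_eq_of_pow_eq_one {G : Type*} [Group G] [Finite G] [IsCyclic G] {n : ℕ}
    (hn : 0 < n) (H : Subgroup G) (hH : Nat.card H = n) {g : G} (hg : g ^ n = 1) : g ∈ H := by
  classical
  cases nonempty_fintype G
  have hsub : (H : Set G).toFinset ⊆ Finset.univ.filter (fun a : G => a ^ n = 1) := by
    intro a ha
    rw [Set.mem_toFinset] at ha
    have h : (⟨a, ha⟩ : H) ^ n = 1 := hH ▸ pow_card_eq_one'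
    simpa using congrArg Subtype.val h
  have hcard : (H : Set G).toFinset.card = n := by
    rw [Set.toFinset_card, ← hH, ← Nat.card_eq_fintype_card]
    rfl
  have heq := Finset.eq_of_subset_of_card_le hsub
    ((IsCyclic.card_pow_eq_one_le hn).trans hcard.ge)
  have hmem : g ∈ (H : Set G).toFinset := heq ▸ by simpa using hg
  simpa using hmem

/-- The preimage of the subgroup of prime order `p` of a finite cyclic group under an injective
homomorphism from a group of order divisible by `p` has order `p`. -/
lemma Subgroup.card_comap_of_isCyclic_of_prime {Γ G : Type*} [Group Γ] [Finite Γ] [Group G]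
    [Finite G] [IsCyclic G] {p : ℕ} (hp : p.Prime) (r : Γ →* G) (hr : Function.Injective r)
    (hΓ : p ∣ Nat.card Γ) (H : Subgroup G) (hH : Nat.card H = p) :
    Nat.card (H.comap r) = p := by
  have := Fact.mk hp
  obtain ⟨g, hg⟩ := exists_prime_orderOf_dvd_card' p hΓ
  have hgH : r g ∈ H := H.mem_of_card_eq_of_pow_eq_one hp.pos hH
    (by rw [← map_pow, ← hg, pow_orderOf_eq_one, map_one])
  refine le_antisymm ?_ ?_
  · rw [← hH]
    exact Nat.card_le_card_of_injective (fun x : H.comap r => (⟨r x, x.2⟩ : H))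
      fun x y hxy => Subtype.ext (hr (congrArg Subtype.val hxy))
  · rw [← hg, ← Nat.card_zpowers]
    exact Subgroup.card_le_of_le (by simpa using hgH)

/-- A domain that is a quotient of a finite power of a field `N` has the same degree as `N`. -/
lemma finrank_eq_of_surjective_pi {F N L ι : Type*} [Field F] [Field N] [Algebra F N] [CommRing L]
    [IsDomain L] [Algebra F L] [Finite ι] (g : (ι → N) →ₐ[F] L)
    (hg : Function.Surjective g) : Module.finrank F L = Module.finrank F N := by
  classical
  cases nonempty_fintype ι
  obtain ⟨i, hi⟩ : ∃ i, g (Pi.single i 1) ≠ 0 := by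
    by_contra! h
    have h1 : g 1 = 0 := by
      rw [← Finset.univ_sum_single (1 : ι → N), map_sum]
      exact Finset.sum_eq_zero fun i _ => h i
    exact one_ne_zero ((map_one g).symm.trans h1)
  have hone : g (Pi.single i 1) = 1 := by
    refine mul_left_cancel₀ hi ?_
    rw [← map_mul, ← Pi.single_mul, mul_one, mul_one]
  let f : N →ₗ[F] L := g.toLinearMap ∘ₗ LinearMap.single F (fun _ : ι => N) i
  have hf : ∀ x, f x = g (Pi.single i x) := fun x => rfl
  refine (LinearEquiv.ofBijective f ⟨?_, fun y => ?_⟩).finrank_eq.symm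
  · rw [injective_iff_map_eq_zero]
    intro x hx
    by_contra hx0
    refine one_ne_zero (α := L) ?_
    rw [← hone, ← mul_inv_cancel₀ hx0, Pi.single_mul, map_mul, ← hf, hx, zero_mul]
  · obtain ⟨x, rfl⟩ := hg y
    refine ⟨x i, ?_⟩
    rw [hf, ← mul_one (g x), ← hone, ← map_mul]
    congr 1
    ext j
    rcases eq_or_ne j i with rfl | h <;> simp [*]

/-- Proposition 5.5: let `K/k` be cyclic of degree `p^e` (`e ≥ 1`), `K₀` the intermediate field
of degree `p^(e-1)`, and `F/k` any field extension. If `K ⊗_k F` is a product of copies of a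
cyclic extension of `F` of degree `p^{e_F}` and `K₀ ⊗_k F` is a product of copies of a cyclic
extension of `F` of degree `p^{f_F}`, then `f_F ≤ e_F`, `f_F ≥ e_F - 1`, and `e_F = f_F + 1`
whenever `e_F ≠ 0`. -/
theorem degrees_of_base_change_of_cyclic_subextension (k : Type) [Field k]
    (p e : ℕ) (hp : p.Prime) (he : 1 ≤ e)
    (K : Type) [Field K] [Algebra k K] [FiniteDimensional k K]
    [IsGalois k K] [IsCyclic (K ≃ₐ[k] K)]
    (hK : Module.finrank k K = p ^ e)
    (K₀ : IntermediateField k K) (hK₀ : Module.finrank k K₀ = p ^ (e - 1))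
    (F : Type) [Field F] [Algebra k F]
    (eF fF : ℕ)
    (M : Type) [Field M] [Algebra F M] [FiniteDimensional F M] [IsGalois F M]
    (hMcyc : IsCyclic (M ≃ₐ[F] M)) (hMdeg : Module.finrank F M = p ^ eF)
    (hKF : ∃ n : ℕ, Nonempty ((F ⊗[k] K) ≃ₐ[F] (Fin n → M)))
    (N : Type) [Field N] [Algebra F N] [FiniteDimensional F N] [IsGalois F N]
    (hNcyc : IsCyclic (N ≃ₐ[F] N)) (hNdeg : Module.finrank F N = p ^ fF)
    (hK₀F : ∃ n : ℕ, Nonempty ((F ⊗[k] (↥K₀)) ≃ₐ[F] (Fin n → N))) :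
    fF ≤ eF ∧ eF - 1 ≤ fF ∧ (eF ≠ 0 → eF = fF + 1) := by
  obtain ⟨m, ⟨φ⟩⟩ := hKF
  obtain ⟨n, ⟨ψ⟩⟩ := hK₀F
  have i₀ : Fin m := by
    rcases m with _ | m
    · exact absurd (φ.injective (Subsingleton.elim (φ 1) (φ 0))) one_ne_zero
    · exact 0
  let π : F ⊗[k] K →ₐ[F] M := (Pi.evalAlgHom F (fun _ : Fin m => M) i₀).comp φ.toAlgHom
  have hπ : Function.Surjective π := fun y =>
    ⟨φ.symm fun _ => y, by simp [π]⟩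
  let : Algebra k M := ((algebraMap F M).comp (algebraMap k F)).toAlgebra
  have : IsScalarTower k F M := IsScalarTower.of_algebraMap_eq fun _ => rfl
  let ι : K →ₐ[k] M := (π.restrictScalars k).comp Algebra.TensorProduct.includeRight
  let : Algebra K M := ι.toRingHom.toAlgebra
  have : IsScalarTower k K M := IsScalarTower.of_algebraMap_eq fun x => (ι.commutes x).symm
  have hι : ∀ x : K, algebraMap K M x = π (1 ⊗ₜ x) := fun _ => rfl
  let r : (M ≃ₐ[F] M) →* (K ≃ₐ[k] K) :=
    IntermediateField.restrictRestrictAlgEquivMapHom k K F M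
  have hr : ∀ (σ : M ≃ₐ[F] M) (x : K), algebraMap K M (r σ x) = σ (algebraMap K M x) :=
    fun σ x => AlgEquiv.restrictNormal_commutes (MulSemiringAction.toAlgAut (M ≃ₐ[F] M) k M σ) K x
  have hrinj : Function.Injective r := by
    rw [injective_iff_map_eq_one]
    intro σ hσ
    have hcomp : σ.toAlgHom.comp π = π := by
      ext x
      change σ (π (1 ⊗ₜ x)) = π (1 ⊗ₜ x)
      rw [← hι, ← hr, hσ, AlgEquiv.one_apply]
    ext y
    obtain ⟨t, rfl⟩ := hπ y
    exact DFunLike.congr_fun hcomp t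
  let π₀ : F ⊗[k] K₀ →ₐ[F] M := π.comp (Algebra.TensorProduct.map (AlgHom.id F F) K₀.val)
  have hπ₀ : ∀ x : K₀, π₀ (1 ⊗ₜ x) = algebraMap K M x := fun x => by simp [π₀, hι]
  let L : IntermediateField F M := subalgebraEquivIntermediateField π₀.range
  have hL : ∀ y, y ∈ L ↔ ∃ t, π₀ t = y := fun y => mem_subalgebraEquivIntermediateField
  have hLdeg : Module.finrank F L = p ^ fF := by
    rw [← hNdeg]
    exact finrank_eq_of_surjective_pi (π₀.rangeRestrict.comp ψ.symm.toAlgHom)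
      (π₀.rangeRestrict_surjective.comp ψ.symm.surjective)
  have hfix : L.fixingSubgroup = K₀.fixingSubgroup.comap r := by
    ext σ
    rw [Subgroup.mem_comap, IntermediateField.mem_fixingSubgroup_iff,
      IntermediateField.mem_fixingSubgroup_iff]
    constructor
    · intro h x hx
      refine (algebraMap K M).injective ?_
      rw [hr]
      exact h _ ((hL _).2 ⟨1 ⊗ₜ ⟨x, hx⟩, hπ₀ _⟩)
    · intro h y hy
      obtain ⟨t, rfl⟩ := (hL y).1 hy
      have hcomp : σ.toAlgHom.comp π₀ = π₀ := by
        ext x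
        change σ (π₀ (1 ⊗ₜ x)) = π₀ (1 ⊗ₜ x)
        rw [hπ₀, ← hr, h x x.2]
      exact DFunLike.congr_fun hcomp t
  have htower := Module.finrank_mul_finrank F L M
  rw [hLdeg, hMdeg] at htower
  rcases Nat.eq_zero_or_pos eF with h0 | h0
  · have hf0 : fF = 0 := by
      have h1 : p ^ fF = 1 := Nat.eq_one_of_mul_eq_one_right (by rw [htower, h0, pow_zero])
      exact (Nat.pow_eq_one.1 h1).resolve_left hp.ne_one
    omega
  · have hK₀K : Nat.card K₀.fixingSubgroup = p := by
      rw [IsGalois.card_fixingSubgroup_eq_finrank]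
      have h := Module.finrank_mul_finrank k K₀ K
      rw [hK₀, hK, ← Nat.sub_add_cancel he, pow_succ, Nat.add_sub_cancel] at h
      exact Nat.eq_of_mul_eq_mul_left (pow_pos hp.pos _) h
    have hdvd : p ∣ Nat.card (M ≃ₐ[F] M) := by
      rw [IsGalois.card_aut_eq_finrank, hMdeg]
      exact dvd_pow_self p h0.ne'
    have hML : Module.finrank L M = p := by
      rw [← IsGalois.card_fixingSubgroup_eq_finrank, hfix]
      exact Subgroup.card_comap_of_isCyclic_of_prime hp r hrinj hdvd _ hK₀K
    rw [hML, ← pow_succ] at htower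
    have := Nat.pow_right_injective hp.two_le htower
    omega
end

section
/- Let p be a prime, m ≥ 1, and e_1 ≥ e_2 ≥ ⋯ ≥ e_m ≥ 0 integers. For s ≥ t let π_{s,t} : ℤ/p^sℤ → ℤ/p^tℤ denote the canonical projection, and for x ∈ ℤ/p^sℤ, y ∈ ℤ/p^tℤ let δ(x,y) be the greatest integer d with 0 ≤ d ≤ min{s,t} and π_{s,d}(x) = π_{t,d}(y). Let Ω be a set and for each i ∈ {1,…,m} let Σ_i : ℕ → (subsets of Ω) be a nondecreasing family, i.e. Σ_i(d) ⊆ Σ_i(d') whenever d ≤ d'. For a = (a_1,…,a_m) ∈ ⊕_{i=1}^m ℤ/p^{e_i}ℤ and n ∈ ℤ/p^{e_1}ℤ, set I_n(a) = {i : π_{e_1,e_i}(n) = a_i}, and define Ω(I_n(a)) = Ω if I_n(a) = {1,…,m} and Ω(I_n(a)) = ⋂_{i ∉ I_n(a)} Σ_i(δ(n, a_i)) otherwise. Then the set G = {a ∈ ⊕_{i=1}^m ℤ/p^{e_i}ℤ : ⋃_{n ∈ ℤ/p^{e_1}ℤ} Ω(I_n(a)) = Ω} is a subgroup of ⊕_{i=1}^m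 ℤ/p^{e_i}ℤ. (Lemma 5.1, in the generality in which its proof applies: the only property of the sets Σ_i^d used is monotonicity in d.) -/
open scoped Classical

noncomputable section

/-- The canonical projection `π_{s,t} : ℤ/p^sℤ → ℤ/p^tℤ` (reduction, meaningful for `t ≤ s`). -/
def zmodProj (p s t : ℕ) (x : ZMod (p ^ s)) : ZMod (p ^ t) := ZMod.cast x

/-- `δ(x,y)`: the greatest `d ≤ min s t` such that `π_{s,d}(x) = π_{t,d}(y)`. -/
def zmodDelta (p s t : ℕ) (x : ZMod (p ^ s)) (y : ZMod (p ^ t)) : ℕ :=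
  Nat.findGreatest (fun d => zmodProj p s d x = zmodProj p t d y) (min s t)

variable (p m : ℕ) (e : Fin m → ℕ) (hm : 0 < m)

/-- `I_n(a) = {i ∈ {1,…,m} | n dominates a_i}`, i.e. `π_{e₁,e_i}(n) = a_i`. -/
def Iset (a : ∀ i, ZMod (p ^ e i)) (n : ZMod (p ^ e ⟨0, hm⟩)) : Set (Fin m) :=
  {i | zmodProj p (e ⟨0, hm⟩) (e i) n = a i}

variable (Ω : Type) (S : Fin m → ℕ → Set Ω)

/-- `Ω(I_n(a))`: all of `Ω` if `I_n(a)` is everything, and otherwise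
`⋂_{i ∉ I_n(a)} Σ_i(δ(n, a_i))`. -/
def OmegaSet (a : ∀ i, ZMod (p ^ e i)) (n : ZMod (p ^ e ⟨0, hm⟩)) : Set Ω :=
  if Iset p m e hm a n = Set.univ then Set.univ
  else ⋂ i ∈ (Iset p m e hm a n)ᶜ, S i (zmodDelta p (e ⟨0, hm⟩) (e i) n (a i))

/-- The set `G` of elements `a` such that the sets `Ω(I_n(a))` cover `Ω`. -/
def Gset : Set (∀ i, ZMod (p ^ e i)) :=
  {a | (⋃ n : ZMod (p ^ e ⟨0, hm⟩), OmegaSet p m e hm Ω S a n) = Set.univ}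

theorem zmodProj_add {p s t : ℕ} (h : t ≤ s) (x y : ZMod (p ^ s)) :
    zmodProj p s t (x + y) = zmodProj p s t x + zmodProj p s t y :=
  map_add (ZMod.castHom (pow_dvd_pow p h) (ZMod (p ^ t))) x y

theorem zmodProj_neg {p s t : ℕ} (h : t ≤ s) (x : ZMod (p ^ s)) :
    zmodProj p s t (-x) = -zmodProj p s t x :=
  map_neg (ZMod.castHom (pow_dvd_pow p h) (ZMod (p ^ t))) x

theorem zmodProj_zero (p s t : ℕ) : zmodProj p s t 0 = 0 :=
  ZMod.cast_zero

theorem zmodProj_self (p s : ℕ) (x : ZMod (p ^ s)) : zmodProj p s s x = x :=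
  ZMod.cast_id _ x

theorem zmodProj_zmodProj {p s t u : ℕ} (hts : t ≤ s) (hut : u ≤ t) (x : ZMod (p ^ s)) :
    zmodProj p t u (zmodProj p s t x) = zmodProj p s u x :=
  congrArg (fun φ : ZMod (p ^ s) →+* ZMod (p ^ u) => φ x)
    (ZMod.castHom_comp (pow_dvd_pow p hut) (pow_dvd_pow p hts))

theorem zmodProj_eq_of_le_zmodDelta {p s t d : ℕ} {x : ZMod (p ^ s)} {y : ZMod (p ^ t)}
    (hd : d ≤ zmodDelta p s t x y) : zmodProj p s d x = zmodProj p t d y := by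
  have hle : zmodDelta p s t x y ≤ min s t := Nat.findGreatest_le _
  have heq : zmodProj p s (zmodDelta p s t x y) x = zmodProj p t (zmodDelta p s t x y) y := by
    refine Nat.findGreatest_spec (P := fun d => zmodProj p s d x = zmodProj p t d y)
      (Nat.zero_le (min s t)) ?_
    have : Subsingleton (ZMod (p ^ 0)) := inferInstanceAs (Subsingleton (ZMod 1))
    exact Subsingleton.elim _ _
  rw [← zmodProj_zmodProj (hle.trans (min_le_left s t)) hd x, heq,
    zmodProj_zmodProj (hle.trans (min_le_right s t)) hd]

theorem le_zmodDelta {p s t d : ℕ} {x : ZMod (p ^ s)} {y : ZMod (p ^ t)}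
    (hd : d ≤ min s t) (h : zmodProj p s d x = zmodProj p t d y) : d ≤ zmodDelta p s t x y :=
  Nat.le_findGreatest hd h

/-- For a monotone family of sets `T`, the condition that `x` projects to `y` or that `ω` lies in
`T (δ(x, y))` is a congruence between `x` and `y` modulo a fixed power of `p`. -/
theorem exists_level_forall_iff {p s t : ℕ} (hts : t ≤ s) {Ω : Type} {T : ℕ → Set Ω}
    (hT : Monotone T) (ω : Ω) :
    ∃ f ≤ t, ∀ (x : ZMod (p ^ s)) (y : ZMod (p ^ t)),
      (zmodProj p s t x ≠ y → ω ∈ T (zmodDelta p s t x y)) ↔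
        zmodProj p s f x = zmodProj p t f y := by
  have hex : ∃ d, d = t ∨ ω ∈ T d := ⟨t, Or.inl rfl⟩
  have hft : Nat.find hex ≤ t := Nat.find_min' hex (Or.inl rfl)
  refine ⟨Nat.find hex, hft, fun x y => ⟨fun h => ?_, fun h hne => ?_⟩⟩
  · by_cases hxy : zmodProj p s t x = y
    · rw [← hxy, zmodProj_zmodProj hts hft]
    · exact zmodProj_eq_of_le_zmodDelta (Nat.find_min' hex (Or.inr (h hxy)))
  · rcases Nat.find_spec hex with hf | hf
    · rw [hf, zmodProj_self] at h
      exact absurd h hne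
    · exact hT (le_zmodDelta (le_min (hft.trans hts) hft) h) hf

theorem mem_OmegaSet_iff {p m : ℕ} {e : Fin m → ℕ} {hm : 0 < m} {Ω : Type}
    {S : Fin m → ℕ → Set Ω} {a : ∀ i, ZMod (p ^ e i)} {n : ZMod (p ^ e ⟨0, hm⟩)} {ω : Ω} :
    ω ∈ OmegaSet p m e hm Ω S a n ↔ ∀ i, zmodProj p (e ⟨0, hm⟩) (e i) n ≠ a i →
      ω ∈ S i (zmodDelta p (e ⟨0, hm⟩) (e i) n (a i)) := by
  unfold OmegaSet
  split_ifs with h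
  · exact iff_of_true trivial fun i hi => absurd (h.ge (Set.mem_univ i)) hi
  · simp [Iset]

theorem mem_Gset_iff {p m : ℕ} {e : Fin m → ℕ} {hm : 0 < m} {Ω : Type}
    {S : Fin m → ℕ → Set Ω} {a : ∀ i, ZMod (p ^ e i)} :
    a ∈ Gset p m e hm Ω S ↔ ∀ ω, ∃ n, ∀ i, zmodProj p (e ⟨0, hm⟩) (e i) n ≠ a i →
      ω ∈ S i (zmodDelta p (e ⟨0, hm⟩) (e i) n (a i)) := by
  simp only [Gset, Set.mem_ofPred_eq, Set.eq_univ_iff_forall, Set.mem_iUnion, mem_OmegaSet_iff]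

/-- Lemma 5.1: if `e₁ ≥ e₂ ≥ ⋯ ≥ e_m ≥ 0` and each family `Σ_i(d)` of subsets of `Ω` is
nondecreasing in `d`, then the set `G` is a subgroup of `⊕ᵢ ℤ/p^{eᵢ}ℤ`. -/
theorem Gset_is_subgroup (hp : p.Prime) (he : Antitone e)
    (hS : ∀ i, Monotone (S i)) :
    ∃ H : AddSubgroup (∀ i, ZMod (p ^ e i)), (H : Set (∀ i, ZMod (p ^ e i))) =
      Gset p m e hm Ω S := by
  have hle : ∀ i, e i ≤ e ⟨0, hm⟩ := fun i => he (Fin.mk_le_of_le_val (Nat.zero_le _))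
  choose f hf hiff using fun (ω : Ω) (i : Fin m) =>
    exists_level_forall_iff (p := p) (hle i) (hS i) ω
  have key : ∀ a, a ∈ Gset p m e hm Ω S ↔ ∀ ω, ∃ n, ∀ i,
      zmodProj p (e ⟨0, hm⟩) (f ω i) n = zmodProj p (e i) (f ω i) (a i) := by
    intro a
    simp only [mem_Gset_iff, hiff]
  refine ⟨{ carrier := Gset p m e hm Ω S, add_mem' := ?_, zero_mem' := ?_, neg_mem' := ?_ }, rfl⟩
  · intro a b ha hb
    rw [key] at ha hb ⊢
    intro ω
    obtain ⟨n, hn⟩ := ha ω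
    obtain ⟨k, hk⟩ := hb ω
    refine ⟨n + k, fun i => ?_⟩
    rw [zmodProj_add ((hf ω i).trans (hle i)), Pi.add_apply, zmodProj_add (hf ω i), hn i, hk i]
  · rw [key]
    exact fun ω => ⟨0, fun i => by rw [zmodProj_zero, Pi.zero_apply, zmodProj_zero]⟩
  · intro a ha
    rw [key] at ha ⊢
    intro ω
    obtain ⟨n, hn⟩ := ha ω
    refine ⟨-n, fun i => ?_⟩
    rw [zmodProj_neg ((hf ω i).trans (hle i)), Pi.neg_apply, zmodProj_neg (hf ω i), hn i]
end
end

section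
/- Let p be a prime, m ≥ 1, and e_1 ≥ e_2 ≥ ⋯ ≥ e_m ≥ 0 integers; write π_{s,t} : ℤ/p^sℤ → ℤ/p^tℤ (for s ≥ t) for the canonical projection. For a = (a_1,…,a_m) ∈ ⊕_{i=1}^m ℤ/p^{e_i}ℤ and n ∈ ℤ/p^{e_1}ℤ, set I_n(a) = {i : π_{e_1,e_i}(n) = a_i}, and let I(a) = (I_0(a), …, I_{p^{e_1}-1}(a)). Call a tuple (I_0, …, I_{p^{e_1}-1}) of subsets of {1,…,m} with ⋃_n I_n = {1,…,m} coherent if for all n_1, n_2 ∈ ℤ/p^{e_1}ℤ: (1) if i ∈ I_{n_1} ∩ I_{n_2} then π_{e_1,e_i}(n_1) = π_{e_1,e_i}(n_2); and (2) if i ∈ I_{n_1} and π_{e_1,e_i}(n_1) = π_{e_1,e_i}(n_2) then i ∈ I_{n_2}. Then the map a ↦ I(a) is a bijection from ⊕_{i=1}^m ℤ/p^{e_i}ℤ onto the set of coherent tuples. (Claim proved in Section 5.1.) -/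
open scoped Classical

noncomputable section

variable (p m : ℕ) (e : Fin m → ℕ) (hm : 0 < m)

/-- A tuple `(I_n)_{n ∈ ℤ/p^{e₁}ℤ}` of subsets of `{1,…,m}` covering `{1,…,m}` is *coherent*
if (1) `i ∈ I_{n₁} ∩ I_{n₂}` implies `π_{e₁,e_i}(n₁) = π_{e₁,e_i}(n₂)`, and (2) `i ∈ I_{n₁}`
and `π_{e₁,e_i}(n₁) = π_{e₁,e_i}(n₂)` imply `i ∈ I_{n₂}`. -/
def Coherent (T : ZMod (p ^ e ⟨0, hm⟩) → Set (Fin m)) : Prop :=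
  (⋃ n, T n) = Set.univ ∧
  (∀ n₁ n₂ : ZMod (p ^ e ⟨0, hm⟩), ∀ i, i ∈ T n₁ → i ∈ T n₂ →
    zmodProj p (e ⟨0, hm⟩) (e i) n₁ = zmodProj p (e ⟨0, hm⟩) (e i) n₂) ∧
  (∀ n₁ n₂ : ZMod (p ^ e ⟨0, hm⟩), ∀ i, i ∈ T n₁ →
    zmodProj p (e ⟨0, hm⟩) (e i) n₁ = zmodProj p (e ⟨0, hm⟩) (e i) n₂ → i ∈ T n₂)

theorem zmodProj_surjective {q s t : ℕ} (hts : t ≤ s) :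
    Function.Surjective (zmodProj q s t) :=
  ZMod.castHom_surjective (pow_dvd_pow q hts)

/-- The claim proved in Section 5.1: `a ↦ I(a) = (I_n(a))_n` is a bijection from
`⊕ᵢ ℤ/p^{eᵢ}ℤ` onto the set of coherent tuples. -/
theorem Iset_bijOn_coherent (hp : p.Prime) (he : Antitone e) :
    Set.BijOn (fun a : ∀ i, ZMod (p ^ e i) => fun n => Iset p m e hm a n)
      Set.univ {T : ZMod (p ^ e ⟨0, hm⟩) → Set (Fin m) | Coherent p m e hm T} := by
  have hsurj (i : Fin m) : Function.Surjective (zmodProj p (e ⟨0, hm⟩) (e i)) :=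
    zmodProj_surjective (he (Fin.mk_le_of_le_val (Nat.zero_le _)))
  refine ⟨fun a _ => ⟨?_, fun n₁ n₂ i h₁ h₂ => Eq.trans h₁ (Eq.symm h₂),
    fun n₁ n₂ i h₁ h => Eq.trans h.symm h₁⟩, fun a _ b _ hab => ?_, ?_⟩
  · exact Set.eq_univ_of_forall fun i => Set.mem_iUnion.2 (hsurj i (a i))
  · funext i
    obtain ⟨n, hn⟩ := hsurj i (a i)
    have hi : i ∈ Iset p m e hm b n := (Set.ext_iff.1 (congrFun hab n) i).1 hn
    exact hn.symm.trans hi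
  · rintro T ⟨hcover, hproj, hclosed⟩
    have hmem (i : Fin m) : ∃ n, i ∈ T n :=
      Set.mem_iUnion.1 (hcover ▸ Set.mem_univ i)
    choose n hn using hmem
    refine ⟨fun i => zmodProj p (e ⟨0, hm⟩) (e i) (n i), Set.mem_univ _, ?_⟩
    funext k
    ext i
    exact ⟨fun h => hclosed (n i) k i (hn i) (Eq.symm h), fun h => hproj k (n i) i h (hn i)⟩
end
end
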